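/- Let A be a ring and I a two-sided ideal of A. If the quotient ring A/I is a completely nilary ring and I is a nil ideal (every element of I is nilpotent), then A is a completely nilary ring. -/

import Mathlib

/-!
Common definitions.

All rings are associative but not necessarily commutative and not necessarily unital,
so we work with `NonUnitalRing` and `TwoSidedIdeal`.

Since a non-unital ring has no `a ^ 0`, positive powers/products are indexed with a shift:
the index `n : ℕ` always corresponds to the positive exponent/length `n + 1`.
-/

/-- `posPow a n` is the positive power `a ^ (n + 1)` of `a`. -/
def posPow {A : Type*} [NonUnitalRing A] (a : A) : ℕ → A
  | 0 => a
  | n + 1 => posPow a n * a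

/-- An element of a (possibly non-unital) ring is nilpotent if
some positive power of it is `0`. -/
def IsNilpotentElem {A : Type*} [NonUnitalRing A] (a : A) : Prop :=
  ∃ n : ℕ, posPow a n = 0

/-- `IsProdLen S n x` means that `x` is a product of `n + 1` elements of `S`
(multiplied in order, which suffices by associativity). -/
inductive IsProdLen {A : Type*} [NonUnitalRing A] (S : Set A) : ℕ → A → Prop
  | single {a : A} : a ∈ S → IsProdLen S 0 a
  | mul {a x : A} {n : ℕ} : a ∈ S → IsProdLen S n x → IsProdLen S (n + 1) (a * x)

/-- The containment `J * K ⊆ I` of two-sided ideals, expressed elementwise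
(this is equivalent, since `J * K` is the additive closure of the set of
products and `I` is closed under addition). -/
def ProdLE {A : Type*} [NonUnitalRing A] (J K I : TwoSidedIdeal A) : Prop :=
  ∀ x ∈ J, ∀ y ∈ K, x * y ∈ I

/-- `J * K = 0` for two-sided ideals `J`, `K`, expressed elementwise. -/
def ProdEqZero {A : Type*} [NonUnitalRing A] (J K : TwoSidedIdeal A) : Prop :=
  ∀ x ∈ J, ∀ y ∈ K, x * y = 0

/-- The containment `J ^ (m + 1) ⊆ I`, expressed elementwise. -/
def PowLE {A : Type*} [NonUnitalRing A] (J : TwoSidedIdeal A) (m : ℕ)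
    (I : TwoSidedIdeal A) : Prop :=
  ∀ x : A, IsProdLen (J : Set A) m x → x ∈ I

/-- `J ^ (m + 1) = 0`, expressed elementwise; so `∃ m, PowEqZero J m` says that
`J` is a nilpotent ideal. -/
def PowEqZero {A : Type*} [NonUnitalRing A] (J : TwoSidedIdeal A) (m : ℕ) : Prop :=
  ∀ x : A, IsProdLen (J : Set A) m x → x = 0

/-- `I` is a completely nilary ideal: whenever `a * b ∈ I`, some positive power of `a`
or some positive power of `b` lies in `I`. -/
def IsCompletelyNilaryIdeal {A : Type*} [NonUnitalRing A] (I : TwoSidedIdeal A) : Prop :=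
  ∀ a b : A, a * b ∈ I → (∃ n : ℕ, posPow a n ∈ I) ∨ (∃ m : ℕ, posPow b m ∈ I)

/-- `A` is a completely nilary ring: whenever `a * b = 0`, `a` is nilpotent or
`b` is nilpotent. -/
def IsCompletelyNilaryRing (A : Type*) [NonUnitalRing A] : Prop :=
  ∀ a b : A, a * b = 0 → IsNilpotentElem a ∨ IsNilpotentElem b

/-- `I` is a nilary ideal: whenever `J * K ⊆ I` for two-sided ideals `J`, `K`, some
positive power of `J` or of `K` is contained in `I`. -/
def IsNilaryIdeal {A : Type*} [NonUnitalRing A] (I : TwoSidedIdeal A) : Prop :=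
  ∀ J K : TwoSidedIdeal A, ProdLE J K I →
    (∃ m : ℕ, PowLE J m I) ∨ (∃ n : ℕ, PowLE K n I)

/-- `A` is a nilary ring: whenever `J * K = 0` for two-sided ideals `J`, `K`, then `J`
or `K` is nilpotent. -/
def IsNilaryRing (A : Type*) [NonUnitalRing A] : Prop :=
  ∀ J K : TwoSidedIdeal A, ProdEqZero J K →
    (∃ m : ℕ, PowEqZero J m) ∨ (∃ n : ℕ, PowEqZero K n)

/-- `I` is a p-nilary ideal: the nilary condition for principal two-sided ideals. -/
def IsPNilaryIdeal {A : Type*} [NonUnitalRing A] (I : TwoSidedIdeal A) : Prop :=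
  ∀ a b : A, ProdLE (TwoSidedIdeal.span {a}) (TwoSidedIdeal.span {b}) I →
    (∃ m : ℕ, PowLE (TwoSidedIdeal.span {a}) m I) ∨
    (∃ n : ℕ, PowLE (TwoSidedIdeal.span {b}) n I)

/-- `A` is a p-nilary ring: whenever `J * K = 0` for principal two-sided ideals `J`, `K`,
then `J` or `K` is nilpotent. -/
def IsPNilaryRing (A : Type*) [NonUnitalRing A] : Prop :=
  ∀ a b : A, ProdEqZero (TwoSidedIdeal.span {a}) (TwoSidedIdeal.span {b}) →
    (∃ m : ℕ, PowEqZero (TwoSidedIdeal.span {a}) m) ∨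
    (∃ n : ℕ, PowEqZero (TwoSidedIdeal.span {b}) n)

/-- `I` is a weakly nilary ideal: `I` is proper, and whenever `0 ≠ J * K ⊆ I` for two-sided
ideals `J`, `K`, some positive power of `J` or of `K` is contained in `I`. -/
def IsWeaklyNilaryIdeal {A : Type*} [NonUnitalRing A] (I : TwoSidedIdeal A) : Prop :=
  I ≠ ⊤ ∧ ∀ J K : TwoSidedIdeal A, ¬ ProdEqZero J K → ProdLE J K I →
    (∃ m : ℕ, PowLE J m I) ∨ (∃ n : ℕ, PowLE K n I)

theorem RingCon.coe_posPow {A : Type*} [NonUnitalRing A] (c : RingCon A) (a : A) (n : ℕ) :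
    ((posPow a n : A) : c.Quotient) = posPow (a : c.Quotient) n := by
  induction n with
  | zero => rfl
  | succ n ih => rw [posPow, posPow, RingCon.coe_mul, ih]

theorem posPow_mul_posPow {A : Type*} [NonUnitalRing A] (a : A) (m n : ℕ) :
    posPow a m * posPow a n = posPow a (m + n + 1) := by
  induction n with
  | zero => rfl
  | succ n ih => rw [posPow, ← mul_assoc, ih, ← posPow, add_assoc m n 1]

theorem posPow_posPow {A : Type*} [NonUnitalRing A] (a : A) (m n : ℕ) :
    posPow (posPow a m) n = posPow a (m * n + m + n) := by
  induction n with
  | zero => simp [posPow]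
  | succ n ih =>
    rw [posPow, ih, posPow_mul_posPow]
    congr 1
    ring

theorem IsNilpotentElem.of_posPow {A : Type*} [NonUnitalRing A] {a : A} {m : ℕ}
    (h : IsNilpotentElem (posPow a m)) : IsNilpotentElem a := by
  obtain ⟨n, hn⟩ := h
  exact ⟨m * n + m + n, by rw [← posPow_posPow, hn]⟩

theorem IsNilpotentElem.of_quotient {A : Type*} [NonUnitalRing A] {I : TwoSidedIdeal A}
    (hnil : ∀ x ∈ I, IsNilpotentElem x) {a : A} (h : IsNilpotentElem (a : I.ringCon.Quotient)) :
    IsNilpotentElem a := by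
  obtain ⟨n, hn⟩ := h
  rw [← RingCon.coe_posPow, ← RingCon.coe_zero, RingCon.eq, ← TwoSidedIdeal.mem_iff] at hn
  exact (hnil _ hn).of_posPow

/-- If `A / I` is a completely nilary ring and `I` is a nil ideal, then
`A` is a completely nilary ring. -/
theorem completelyNilaryRing_of_quotient_of_nil
    {A : Type*} [NonUnitalRing A] (I : TwoSidedIdeal A)
    (hquot : IsCompletelyNilaryRing I.ringCon.Quotient)
    (hnil : ∀ x ∈ I, IsNilpotentElem x) :
    IsCompletelyNilaryRing A := by
  intro a b hab
  exact (hquot a b (by rw [← RingCon.coe_mul, hab, RingCon.coe_zero])).imp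
    (.of_quotient hnil) (.of_quotient hnil)
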